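/- Assume 0 < τ ≤ a and ξ ≥ 2τ/a. Then there exist constants C > 0 and w > 0, depending only on L, a, τ and ξ, such that every smooth solution (u,θ) of the delayed thermoelastic string with Kelvin–Voigt damping satisfies E(t) ≤ C·e^{−wt}·E(0) for all t ≥ 0. -/

import Mathlib

open MeasureTheory intervalIntegral

/-- Partial derivative in the space variable of `f : ℝ → ℝ → ℝ` (first argument). -/
noncomputable def pdX (f : ℝ → ℝ → ℝ) (x t : ℝ) : ℝ := deriv (fun y => f y t) x

/-- Partial derivative in the time variable of `f : ℝ → ℝ → ℝ` (second argument). -/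
noncomputable def pdT (f : ℝ → ℝ → ℝ) (x t : ℝ) : ℝ := deriv (fun s => f x s) t

/-- A smooth solution of the delayed thermoelastic string with Kelvin–Voigt damping. -/
structure IsSmoothSolKVString (L τ a : ℝ) (u θ : ℝ → ℝ → ℝ) : Prop where
  smooth_u : ContDiff ℝ (⊤ : ℕ∞) (fun p : ℝ × ℝ => u p.1 p.2)
  smooth_θ : ContDiff ℝ (⊤ : ℕ∞) (fun p : ℝ × ℝ => θ p.1 p.2)
  pde_u : ∀ x ∈ Set.Ioo (0 : ℝ) L, ∀ t > (0 : ℝ),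
    pdT (pdT u) x t - pdX (pdX u) x (t - τ) - a * pdX (pdX (pdT u)) x t + pdX θ x t = 0
  pde_θ : ∀ x ∈ Set.Ioo (0 : ℝ) L, ∀ t > (0 : ℝ),
    pdT θ x t - pdX (pdX θ) x t + pdX (pdT u) x t = 0
  bc_u : ∀ t : ℝ, -τ ≤ t → u 0 t = 0 ∧ u L t = 0
  bc_θ : ∀ t : ℝ, 0 ≤ t → θ 0 t = 0 ∧ θ L t = 0

/-- The energy of the delayed thermoelastic string with Kelvin–Voigt damping. -/
noncomputable def energyKVString (L τ ξ : ℝ) (u θ : ℝ → ℝ → ℝ) (t : ℝ) : ℝ :=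
  (1 / 2) * ((∫ x in (0 : ℝ)..L, ((pdT u x t) ^ 2 + (pdX u x t) ^ 2 + (θ x t) ^ 2))
    + ξ * ∫ x in (0 : ℝ)..L, ∫ ρ in (0 : ℝ)..(1 : ℝ), (pdX u x (t - τ * ρ)) ^ 2)


open scoped ContDiff

/-- Joint smoothness of a function of two real variables. -/
def Sm (f : ℝ → ℝ → ℝ) : Prop := ContDiff ℝ ∞ (fun p : ℝ × ℝ => f p.1 p.2)

theorem Sm.cont {f : ℝ → ℝ → ℝ} (h : Sm f) : Continuous (fun p : ℝ × ℝ => f p.1 p.2) :=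
  ContDiff.continuous h

theorem Sm.diff {f : ℝ → ℝ → ℝ} (h : Sm f) : Differentiable ℝ (fun p : ℝ × ℝ => f p.1 p.2) :=
  ContDiff.differentiable h (by simp)

theorem Sm.hasX {f : ℝ → ℝ → ℝ} (h : Sm f) (x t : ℝ) :
    HasDerivAt (fun y => f y t) (fderiv ℝ (fun p : ℝ × ℝ => f p.1 p.2) (x, t) (1, 0)) x := by
  have h1 := (h.diff (x, t)).hasFDerivAt
  have h2 : HasDerivAt (fun y : ℝ => (y, t)) ((1 : ℝ), (0 : ℝ)) x :=
    (hasDerivAt_id x).prodMk (hasDerivAt_const x t)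
  exact h1.comp_hasDerivAt x h2

theorem Sm.hasT {f : ℝ → ℝ → ℝ} (h : Sm f) (x t : ℝ) :
    HasDerivAt (fun s => f x s) (fderiv ℝ (fun p : ℝ × ℝ => f p.1 p.2) (x, t) (0, 1)) t := by
  have h1 := (h.diff (x, t)).hasFDerivAt
  have h2 : HasDerivAt (fun s : ℝ => (x, s)) ((0 : ℝ), (1 : ℝ)) t :=
    (hasDerivAt_const t x).prodMk (hasDerivAt_id t)
  exact h1.comp_hasDerivAt t h2

theorem Sm.pdX_eq {f : ℝ → ℝ → ℝ} (h : Sm f) (x t : ℝ) :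
    pdX f x t = fderiv ℝ (fun p : ℝ × ℝ => f p.1 p.2) (x, t) (1, 0) := (h.hasX x t).deriv

theorem Sm.pdT_eq {f : ℝ → ℝ → ℝ} (h : Sm f) (x t : ℝ) :
    pdT f x t = fderiv ℝ (fun p : ℝ × ℝ => f p.1 p.2) (x, t) (0, 1) := (h.hasT x t).deriv

theorem Sm.derX {f : ℝ → ℝ → ℝ} (h : Sm f) (x t : ℝ) :
    HasDerivAt (fun y => f y t) (pdX f x t) x := by
  rw [h.pdX_eq]; exact h.hasX x t

theorem Sm.derT {f : ℝ → ℝ → ℝ} (h : Sm f) (x t : ℝ) :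
    HasDerivAt (fun s => f x s) (pdT f x t) t := by
  rw [h.pdT_eq]; exact h.hasT x t

theorem Sm.fd {f : ℝ → ℝ → ℝ} (h : Sm f) (w : ℝ × ℝ) :
    ContDiff ℝ ∞ (fun p : ℝ × ℝ => fderiv ℝ (fun p : ℝ × ℝ => f p.1 p.2) p w) :=
  (ContDiff.fderiv_right h (m := ∞) (by simp)).clm_apply contDiff_const

theorem Sm.pdX {f : ℝ → ℝ → ℝ} (h : Sm f) : Sm (pdX f) := by
  have := h.fd (1, 0)
  unfold Sm
  convert this using 2 with p
  exact h.pdX_eq _ _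

theorem Sm.pdT {f : ℝ → ℝ → ℝ} (h : Sm f) : Sm (pdT f) := by
  have := h.fd (0, 1)
  unfold Sm
  convert this using 2 with p
  exact h.pdT_eq _ _

theorem Sm.comm {f : ℝ → ℝ → ℝ} (h : Sm f) (x t : ℝ) :
    _root_.pdX (_root_.pdT f) x t = _root_.pdT (_root_.pdX f) x t := by
  rw [h.pdT.pdX_eq, h.pdX.pdT_eq]
  have e1 : (fun p : ℝ × ℝ => _root_.pdT f p.1 p.2)
      = fun p => fderiv ℝ (fun p : ℝ × ℝ => f p.1 p.2) p (0, 1) := by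
    ext p; exact h.pdT_eq _ _
  have e2 : (fun p : ℝ × ℝ => _root_.pdX f p.1 p.2)
      = fun p => fderiv ℝ (fun p : ℝ × ℝ => f p.1 p.2) p (1, 0) := by
    ext p; exact h.pdX_eq _ _
  rw [e1, e2]
  have hd : DifferentiableAt ℝ (fderiv ℝ (fun p : ℝ × ℝ => f p.1 p.2)) (x, t) :=
    (ContDiff.fderiv_right h (m := ∞) (by simp)).differentiable (by simp) _
  have hs : IsSymmSndFDerivAt ℝ (fun p : ℝ × ℝ => f p.1 p.2) (x, t) :=
    (ContDiff.contDiffAt h).isSymmSndFDerivAt (by simp; exact WithTop.coe_le_coe.2 (le_top : (2 : ℕ∞) ≤ ⊤))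
  rw [fderiv_clm_apply hd (by fun_prop), fderiv_clm_apply hd (by fun_prop)]
  simp
  exact hs.eq _ _

/-- Differentiation under the integral sign. -/
theorem hasDerivAt_param (F F' : ℝ → ℝ → ℝ) (a b : ℝ)
    (hF : Continuous (fun p : ℝ × ℝ => F p.1 p.2))
    (hF' : Continuous (fun p : ℝ × ℝ => F' p.1 p.2))
    (hd : ∀ x t, HasDerivAt (fun s => F x s) (F' x t) t) (t : ℝ) :
    HasDerivAt (fun s => ∫ x in a..b, F x s) (∫ x in a..b, F' x t) t := by
  obtain ⟨C, hC⟩ := ((isCompact_uIcc (a := a) (b := b)).prod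
    (isCompact_Icc (a := t - 1) (b := t + 1))).exists_bound_of_continuousOn hF'.continuousOn
  refine (intervalIntegral.hasDerivAt_integral_of_dominated_loc_of_deriv_le (bound := fun _ => C)
    (F := fun s x => F x s) (F' := fun s x => F' x s)
    (s := Set.Icc (t - 1) (t + 1)) (Icc_mem_nhds (by linarith) (by linarith)) ?_ ?_ ?_ ?_ ?_ ?_).2
  · refine Filter.Eventually.of_forall fun s => ?_
    exact (hF.comp (by fun_prop : Continuous fun x : ℝ => (x, s))).aestronglyMeasurable
  · exact (hF.comp (by fun_prop : Continuous fun x : ℝ => (x, t))).intervalIntegrable _ _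
  · exact (hF'.comp (by fun_prop : Continuous fun x : ℝ => (x, t))).aestronglyMeasurable
  · refine Filter.Eventually.of_forall fun x hx s hs => ?_
    exact hC (x, s) ⟨Set.uIoc_subset_uIcc hx, hs⟩
  · simp
  · exact Filter.Eventually.of_forall fun x _ s _ => hd x s

theorem cont_param (F : ℝ → ℝ → ℝ → ℝ) (b : ℝ)
    (hF : Continuous (fun p : (ℝ × ℝ) × ℝ => F p.1.1 p.1.2 p.2)) :
    Continuous (fun p : ℝ × ℝ => ∫ r in (0:ℝ)..b, F p.1 p.2 r) :=
  intervalIntegral.continuous_parametric_intervalIntegral_of_continuous'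
    (f := fun (p : ℝ × ℝ) r => F p.1 p.2 r) hF 0 b

/-- Window derivative, unintegrated form. -/
theorem window_deriv (k q q' : ℝ → ℝ) (b : ℝ) (hk : Continuous k) (hq' : Continuous q')
    (hd : ∀ t, HasDerivAt q (q' t) t) (t : ℝ) :
    HasDerivAt (fun s => ∫ r in (0:ℝ)..b, k r * q (s - r)) (∫ r in (0:ℝ)..b, k r * q' (t - r)) t := by
  have hq : Continuous q := continuous_iff_continuousAt.2 fun t => (hd t).continuousAt
  refine hasDerivAt_param (fun r s => k r * q (s - r)) (fun r s => k r * q' (s - r)) 0 b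
    (by fun_prop) (by fun_prop) ?_ t
  intro r s
  have := (hd (s - r)).comp s ((hasDerivAt_id s).sub_const r)
  simpa using this.const_mul (k r)

theorem window_parts (k k' q q' : ℝ → ℝ) (b : ℝ) (hk : ∀ r, HasDerivAt k (k' r) r)
    (hk' : Continuous k') (hq' : Continuous q')
    (hd : ∀ t, HasDerivAt q (q' t) t) (t : ℝ) :
    ∫ r in (0:ℝ)..b, k r * q' (t - r)
      = k 0 * q t - k b * q (t - b) + ∫ r in (0:ℝ)..b, k' r * q (t - r) := by
  have hq : Continuous q := continuous_iff_continuousAt.2 fun t => (hd t).continuousAt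
  have hkc : Continuous k := continuous_iff_continuousAt.2 fun t => (hk t).continuousAt
  have h1 : ∀ r ∈ Set.uIcc 0 b, HasDerivAt (fun r => k r * q (t - r))
      (k' r * q (t - r) - k r * q' (t - r)) r := by
    intro r _
    have := (hd (t - r)).comp r ((hasDerivAt_id r).const_sub t)
    have h2 := (hk r).mul this
    refine h2.congr_deriv ?_
    simp; ring
  have h3 := intervalIntegral.integral_eq_sub_of_hasDerivAt h1
    (Continuous.intervalIntegrable (by fun_prop) _ _)
  rw [intervalIntegral.integral_sub (Continuous.intervalIntegrable (by fun_prop) _ _)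
    (Continuous.intervalIntegrable (by fun_prop) _ _)] at h3
  simp at h3
  linarith

/-- Poincaré inequality. -/
theorem poincare (L : ℝ) (hL : 0 < L) (h h' : ℝ → ℝ) (hd : ∀ x, HasDerivAt h (h' x) x)
    (hc : Continuous h') (h0 : h L = 0) :
    ∫ x in (0:ℝ)..L, h x ^ 2 ≤ 4 * L ^ 2 * ∫ x in (0:ℝ)..L, h' x ^ 2 := by
  have hh : Continuous h := continuous_iff_continuousAt.2 fun t => (hd t).continuousAt
  have h1 : ∀ x ∈ Set.uIcc 0 L, HasDerivAt (fun x => x * h x ^ 2)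
      (h x ^ 2 + 2 * x * h x * h' x) x := by
    intro x _
    have := (hasDerivAt_id x).mul ((hd x).pow 2)
    refine this.congr_deriv ?_
    simp; ring
  have h3 := intervalIntegral.integral_eq_sub_of_hasDerivAt h1
    (Continuous.intervalIntegrable (by fun_prop) _ _)
  simp [h0] at h3
  have h4 : ∫ x in (0:ℝ)..L, (h x ^ 2 / 2 - 2 * L ^ 2 * h' x ^ 2) ≤
      ∫ x in (0:ℝ)..L, (h x ^ 2 + 2 * x * h x * h' x) := by
    refine intervalIntegral.integral_mono_on hL.le (Continuous.intervalIntegrable (by fun_prop) _ _)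
      (Continuous.intervalIntegrable (by fun_prop) _ _) ?_
    intro x hx
    have hx2 : x ^ 2 ≤ L ^ 2 := pow_le_pow_left₀ hx.1 hx.2 2
    nlinarith [sq_nonneg (h x + 2 * x * h' x), mul_le_mul_of_nonneg_right hx2 (sq_nonneg (h' x))]
  rw [h3, intervalIntegral.integral_sub (Continuous.intervalIntegrable (by fun_prop) _ _)
    (Continuous.intervalIntegrable (by fun_prop) _ _), intervalIntegral.integral_div,
    intervalIntegral.integral_const_mul] at h4
  linarith

/-- Integration by parts with vanishing boundary values. -/
theorem parts0 (L : ℝ) (h h' k k' : ℝ → ℝ) (hd : ∀ x, HasDerivAt h (h' x) x)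
    (kd : ∀ x, HasDerivAt k (k' x) x) (hc : Continuous h') (kc : Continuous k')
    (h0 : h 0 = 0) (hL : h L = 0) :
    ∫ x in (0:ℝ)..L, h x * k' x = - ∫ x in (0:ℝ)..L, h' x * k x := by
  have := intervalIntegral.integral_mul_deriv_eq_deriv_mul (a := 0) (b := L)
    (fun x _ => hd x) (fun x _ => kd x)
    (hc.intervalIntegrable _ _) (kc.intervalIntegrable _ _)
  rw [this, h0, hL]; simp

theorem gronwall' (V V' : ℝ → ℝ) (c t0 : ℝ) (hd : ∀ t ≥ t0, HasDerivAt V (V' t) t)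
    (hle : ∀ t ≥ t0, V' t ≤ c * V t) (t : ℝ) (ht : t0 ≤ t) :
    V t ≤ V t0 * Real.exp (c * (t - t0)) := by
  have hd2 : ∀ s ≥ t0, HasDerivAt (fun s => V s * Real.exp (-(c * (s - t0))))
      ((V' s - c * V s) * Real.exp (-(c * (s - t0)))) s := by
    intro s hs
    have h1 : HasDerivAt (fun s => -(c * (s - t0))) (-c) s := by
      refine (((hasDerivAt_id s).sub_const t0).const_mul c).neg.congr_deriv ?_
      ring
    refine ((hd s hs).mul h1.exp).congr_deriv ?_
    ring
  have hanti : AntitoneOn (fun s => V s * Real.exp (-(c * (s - t0)))) (Set.Ici t0) := by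
    refine antitoneOn_of_deriv_nonpos (convex_Ici t0)
      (fun s hs => (hd2 s hs).continuousAt.continuousWithinAt) ?_ ?_
    · intro s hs; rw [interior_Ici] at hs
      exact (hd2 s (le_of_lt hs)).differentiableAt.differentiableWithinAt
    · intro s hs; rw [interior_Ici] at hs
      rw [(hd2 s (le_of_lt hs)).deriv]
      exact mul_nonpos_of_nonpos_of_nonneg (by linarith [hle s (le_of_lt hs)]) (Real.exp_pos _).le
  have := hanti (Set.mem_Ici.2 le_rfl) (Set.mem_Ici.2 ht) ht
  simp at this
  rw [Real.exp_neg, ← div_eq_mul_inv, div_le_iff₀ (Real.exp_pos _)] at this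
  exact this


/-- Two integrals agree when the integrands differ by a derivative vanishing at the ends. -/
theorem int_eq_of_flux (L : ℝ) (hL : 0 < L) (P Q Φ : ℝ → ℝ) (hP : Continuous P) (hQ : Continuous Q)
    (h : ∀ x ∈ Set.Icc 0 L, HasDerivAt Φ (P x - Q x) x) (h0 : Φ 0 = 0) (h1 : Φ L = 0) :
    ∫ x in (0:ℝ)..L, P x = ∫ x in (0:ℝ)..L, Q x := by
  have h3 := intervalIntegral.integral_eq_sub_of_hasDerivAt (a := 0) (b := L) (f := Φ)
    (f' := fun x => P x - Q x) (by rw [Set.uIcc_of_le hL.le]; exact h)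
    (Continuous.intervalIntegrable (by fun_prop) _ _)
  rw [intervalIntegral.integral_sub (hP.intervalIntegrable _ _) (hQ.intervalIntegrable _ _),
    h0, h1] at h3
  linarith

theorem ibp_F (L a : ℝ) (hL : 0 < L) (v vt g gd gdx f fx θ θt θx θxx : ℝ → ℝ)
    (hv : ∀ x, HasDerivAt v (f x) x) (hgd : ∀ x, HasDerivAt gd (gdx x) x)
    (hf : ∀ x, HasDerivAt f (fx x) x) (hθ : ∀ x, HasDerivAt θ (θx x) x)
    (hθx : ∀ x, HasDerivAt θx (θxx x) x)
    (cvt : Continuous vt) (cg : Continuous g) (cθt : Continuous θt)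
    (p1 : ∀ x ∈ Set.Icc 0 L, vt x - gdx x - a * fx x + θx x = 0)
    (p2 : ∀ x ∈ Set.Icc 0 L, θt x - θxx x + f x = 0)
    (v0 : v 0 = 0) (vL : v L = 0) (t0 : θ 0 = 0) (tL : θ L = 0) :
    ∫ x in (0:ℝ)..L, (v x * vt x + g x * f x + θ x * θt x)
      = ∫ x in (0:ℝ)..L, (f x * (g x - gd x) - a * f x ^ 2 - θx x ^ 2) := by
  have cv : Continuous v := continuous_iff_continuousAt.2 fun t => (hv t).continuousAt
  have cgd : Continuous gd := continuous_iff_continuousAt.2 fun t => (hgd t).continuousAt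
  have cf : Continuous f := continuous_iff_continuousAt.2 fun t => (hf t).continuousAt
  have cθ : Continuous θ := continuous_iff_continuousAt.2 fun t => (hθ t).continuousAt
  have cθx : Continuous θx := continuous_iff_continuousAt.2 fun t => (hθx t).continuousAt
  refine int_eq_of_flux L hL _ _ (fun x => v x * gd x + a * (v x * f x) - v x * θ x + θ x * θx x)
    (by fun_prop) (by fun_prop) ?_ (by simp [v0, t0]) (by simp [vL, tL])
  intro x hx
  have h := ((((hv x).mul (hgd x)).add (((hv x).mul (hf x)).const_mul a)).sub
    ((hv x).mul (hθ x))).add ((hθ x).mul (hθx x))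
  refine h.congr_deriv ?_
  have e1 : vt x = gdx x + a * fx x - θx x := by linarith [p1 x hx]
  have e2 : θt x = θxx x - f x := by linarith [p2 x hx]
  rw [e1, e2]; ring

theorem ibp_N (L a τ : ℝ) (hL : 0 < L) (u v vt g gd gdx f fx θ θx : ℝ → ℝ)
    (hu : ∀ x, HasDerivAt u (g x) x) (hgd : ∀ x, HasDerivAt gd (gdx x) x)
    (hf : ∀ x, HasDerivAt f (fx x) x) (hθ : ∀ x, HasDerivAt θ (θx x) x)
    (cv : Continuous v) (cvt : Continuous vt) (cg : Continuous g)
    (p1 : ∀ x ∈ Set.Icc 0 L, vt x - gdx x - a * fx x + θx x = 0)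
    (u0 : u 0 = 0) (uL : u L = 0) :
    ∫ x in (0:ℝ)..L, (v x ^ 2 + u x * vt x + (a - τ) * (g x * f x))
      = ∫ x in (0:ℝ)..L, (v x ^ 2 - g x * gd x - τ * (g x * f x) + g x * θ x) := by
  have cu : Continuous u := continuous_iff_continuousAt.2 fun t => (hu t).continuousAt
  have cgd : Continuous gd := continuous_iff_continuousAt.2 fun t => (hgd t).continuousAt
  have cf : Continuous f := continuous_iff_continuousAt.2 fun t => (hf t).continuousAt
  have cθ : Continuous θ := continuous_iff_continuousAt.2 fun t => (hθ t).continuousAt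
  refine int_eq_of_flux L hL _ _ (fun x => u x * gd x + a * (u x * f x) - u x * θ x)
    (by fun_prop) (by fun_prop) ?_ (by simp [u0]) (by simp [uL])
  intro x hx
  have h := ((((hu x).mul (hgd x)).add (((hu x).mul (hf x)).const_mul a)).sub
    ((hu x).mul (hθ x)))
  refine h.congr_deriv ?_
  have e1 : vt x = gdx x + a * fx x - θx x := by linarith [p1 x hx]
  rw [e1]; ring

/-- Window part of the Lyapunov density. -/
noncomputable def Wd (τ ε A : ℝ) (g f : ℝ → ℝ) (t : ℝ) : ℝ :=
  1 / 2 * (∫ r in (0:ℝ)..τ, (τ - r) * f (t - r) ^ 2)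
    - ε * A * (g t * ∫ r in (0:ℝ)..τ, (τ - 2 * r) * g (t - r))
    + ε / (8 * τ) * ∫ r in (0:ℝ)..τ, (2 * τ - r) * (f (t - r) ^ 2 + g (t - r) ^ 2)

/-- Its time derivative. -/
noncomputable def Wd' (τ ε A : ℝ) (g f : ℝ → ℝ) (t : ℝ) : ℝ :=
  1 / 2 * (τ * f t ^ 2 - ∫ r in (0:ℝ)..τ, f (t - r) ^ 2)
    - ε * A * (f t * (∫ r in (0:ℝ)..τ, r * (τ - r) * f (t - r))
      + g t * ∫ r in (0:ℝ)..τ, (τ - 2 * r) * f (t - r))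
    + ε / (8 * τ) * (2 * τ * (f t ^ 2 + g t ^ 2) - τ * (f (t - τ) ^ 2 + g (t - τ) ^ 2)
      - ∫ r in (0:ℝ)..τ, (f (t - r) ^ 2 + g (t - r) ^ 2))

theorem Wd_deriv (τ ε A : ℝ) (g f f' : ℝ → ℝ) (hg : ∀ t, HasDerivAt g (f t) t)
    (hf : ∀ t, HasDerivAt f (f' t) t) (cf' : Continuous f') (t : ℝ) :
    HasDerivAt (Wd τ ε A g f) (Wd' τ ε A g f t) t := by
  have cg : Continuous g := continuous_iff_continuousAt.2 fun t => (hg t).continuousAt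
  have cf : Continuous f := continuous_iff_continuousAt.2 fun t => (hf t).continuousAt
  have q1 : ∀ t, HasDerivAt (fun t => f t ^ 2) (2 * f t * f' t) t := fun t => by
    refine ((hf t).pow 2).congr_deriv ?_
    simp
  have q2 : ∀ t, HasDerivAt (fun t => f t ^ 2 + g t ^ 2) (2 * f t * f' t + 2 * g t * f t) t :=
    fun t => by
    refine ((q1 t).add ((hg t).pow 2)).congr_deriv ?_
    simp
  have k1 : ∀ c r : ℝ, HasDerivAt (fun r : ℝ => c - r) (-1) r := fun c r =>
    (hasDerivAt_id r).const_sub c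
  have d1 := window_deriv (fun r => τ - r) _ _ τ (by fun_prop) (by fun_prop) q1 t
  rw [window_parts (fun r => τ - r) (fun _ => -1) _ _ τ (k1 τ) (by fun_prop) (by fun_prop) q1] at d1
  have d2 := window_deriv (fun r => 2 * τ - r) _ _ τ (by fun_prop) (by fun_prop) q2 t
  rw [window_parts (fun r => 2 * τ - r) (fun _ => -1) _ _ τ (k1 _) (by fun_prop) (by fun_prop) q2]
    at d2
  have d3 := window_deriv (fun r => τ - 2 * r) _ _ τ (by fun_prop) (by fun_prop) hg t
  have k3 : ∀ r : ℝ, HasDerivAt (fun r : ℝ => r * (τ - r)) (τ - 2 * r) r := fun r => by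
    refine ((hasDerivAt_id r).mul (k1 τ r)).congr_deriv ?_
    simp; ring
  have e3 := window_parts (fun r => r * (τ - r)) (fun r => τ - 2 * r) _ _ τ k3
    (by fun_prop) (by fun_prop) hg t
  have d := ((d1.const_mul (1 / 2)).sub (((hg t).mul d3).const_mul (ε * A))).add
    (d2.const_mul (ε / (8 * τ)))
  refine d.congr_deriv ?_
  unfold Wd'
  rw [e3]
  simp only [intervalIntegral.integral_const_mul]
  ring

theorem quad_nonneg (α β γ d e : ℝ) (hα : 0 < α) (h : β ^ 2 ≤ 4 * α * γ) :
    0 ≤ α * d ^ 2 + β * (d * e) + γ * e ^ 2 := by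
  have : 0 ≤ 4 * α * (α * d ^ 2 + β * (d * e) + γ * e ^ 2) := by
    nlinarith [sq_nonneg (2 * α * d + β * e), mul_le_mul_of_nonneg_right h (sq_nonneg e)]
  exact nonneg_of_mul_nonneg_right this (by linarith)

theorem int_Q (τ : ℝ) (y : ℝ → ℝ) (cy : Continuous y) (c1 c2 c3 c4 c5 c6 c7 : ℝ) :
    ∫ r in (0:ℝ)..τ, (c1 * y r ^ 2 + c2 * y r + c3 * (r * (τ - r) * y r)
      + c4 * ((τ - 2 * r) * y r) + c5 * (r * (τ - r)) + c6 * (τ - 2 * r) + c7)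
    = c1 * (∫ r in (0:ℝ)..τ, y r ^ 2) + c2 * (∫ r in (0:ℝ)..τ, y r)
      + c3 * (∫ r in (0:ℝ)..τ, r * (τ - r) * y r) + c4 * (∫ r in (0:ℝ)..τ, (τ - 2 * r) * y r)
      + c5 * (τ ^ 3 / 6) + c7 * τ := by
  have i1 : ∫ r in (0:ℝ)..τ, r * (τ - r) = τ ^ 3 / 6 := by
    have h1 : ∀ r ∈ Set.uIcc 0 τ, HasDerivAt (fun r : ℝ => τ * r ^ 2 / 2 - r ^ 3 / 3)
      (r * (τ - r)) r := fun r _ => by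
      refine ((((hasDerivAt_id r).pow 2).const_mul τ).div_const 2 |>.sub
        (((hasDerivAt_id r).pow 3).div_const 3)).congr_deriv ?_
      simp; ring
    rw [intervalIntegral.integral_eq_sub_of_hasDerivAt h1
      (Continuous.intervalIntegrable (by fun_prop) _ _)]
    ring
  have i2 : ∫ r in (0:ℝ)..τ, (τ - 2 * r) = 0 := by
    have h1 : ∀ r ∈ Set.uIcc 0 τ, HasDerivAt (fun r : ℝ => τ * r - r ^ 2)
      (τ - 2 * r) r := fun r _ => by
      refine (((hasDerivAt_id r).const_mul τ).sub ((hasDerivAt_id r).pow 2)).congr_deriv ?_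
      simp
    rw [intervalIntegral.integral_eq_sub_of_hasDerivAt h1
      (Continuous.intervalIntegrable (by fun_prop) _ _)]
    ring
  repeat rw [intervalIntegral.integral_add (Continuous.intervalIntegrable (by fun_prop) _ _)
    (Continuous.intervalIntegrable (by fun_prop) _ _)]
  simp only [intervalIntegral.integral_const_mul, i1, i2, intervalIntegral.integral_const]
  simp; ring

/-- Pointwise (in space) dissipation estimate. -/
theorem key_pt (L τ a ε A : ℝ) (hτ : 0 < τ) (hτa : τ ≤ a) (hε : 0 < ε) (hA : 0 < A)
    (hA6 : A * τ ^ 3 / 6 = 4 * L ^ 2 + 3)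
    (h1 : 4 * τ * ε * (1 + A * τ) ^ 2 ≤ 1) (h2 : ε * A ^ 2 * τ ^ 5 ≤ 1)
    (g f : ℝ → ℝ) (cg : Continuous g) (cf : Continuous f) (t v θ θx : ℝ)
    (hgd : g (t - τ) = g t - ∫ r in (0:ℝ)..τ, f (t - r)) :
    (f t * (g t - g (t - τ)) - a * f t ^ 2 - θx ^ 2)
      + ε * (v ^ 2 - g t * g (t - τ) - τ * (g t * f t) + g t * θ) + Wd' τ ε A g f t
    ≤ ε * v ^ 2 + ε * θ ^ 2 - θx ^ 2 - ε * (4 * L ^ 2 + 1) * f t ^ 2 - ε / 4 * g t ^ 2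
      - ε / (8 * τ) * ∫ r in (0:ℝ)..τ, (f (t - r) ^ 2 + g (t - r) ^ 2) := by
  have hQ : 0 ≤ ∫ r in (0:ℝ)..τ, (1 / 2 * f (t - r) ^ 2 + (-f t - ε * g t) * f (t - r)
      + (ε * A * f t) * (r * (τ - r) * f (t - r))
      + (ε * A * g t) * ((τ - 2 * r) * f (t - r)) + (-ε * A * f t ^ 2) * (r * (τ - r))
      + (-ε * A * g t * f t) * (τ - 2 * r)
      + (1 / 2 * f t ^ 2 + ε * g t * f t + ε * g t ^ 2 / (4 * τ) + ε * f t ^ 2 / τ)) := by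
    refine intervalIntegral.integral_nonneg hτ.le ?_
    intro r hr
    have b1 : (1 - A * (τ - 2 * r)) ^ 2 ≤ (1 + A * τ) ^ 2 := by
      apply sq_le_sq'
      · nlinarith [hr.1, hr.2, mul_nonneg hA.le hr.1]
      · nlinarith [hr.1, hr.2, mul_nonneg hA.le (sub_nonneg.2 hr.2)]
    have b2 : (r * (τ - r)) ^ 2 ≤ τ ^ 4 := by
      have : r * (τ - r) ≤ τ * τ := mul_le_mul hr.2 (by linarith [hr.1]) (by linarith [hr.2]) hτ.le
      have h0 : 0 ≤ r * (τ - r) := mul_nonneg hr.1 (by linarith [hr.2])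
      calc (r * (τ - r)) ^ 2 ≤ (τ * τ) ^ 2 := pow_le_pow_left₀ h0 this 2
        _ = τ ^ 4 := by ring
    have c1 := quad_nonneg (1 / 4) (-ε * (1 - A * (τ - 2 * r))) (ε / (4 * τ)) (f (t - r) - f t) (g t)
      (by norm_num) (by
        have : 4 * (1 / 4) * (ε / (4 * τ)) = ε / (4 * τ) := by ring
        rw [this, le_div_iff₀ (by positivity)]
        have := mul_le_mul_of_nonneg_left b1 (by positivity : 0 ≤ ε * (4 * τ * ε))
        have := mul_le_mul_of_nonneg_left h1 hε.le
        nlinarith)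
    have c2 := quad_nonneg (1 / 4) (ε * A * (r * (τ - r))) (ε / τ) (f (t - r) - f t) (f t)
      (by norm_num) (by
        have : 4 * (1 / 4) * (ε / τ) = ε / τ := by ring
        rw [this, le_div_iff₀ (by positivity)]
        have := mul_le_mul_of_nonneg_left b2 (by positivity : 0 ≤ ε * (ε * A ^ 2 * τ))
        have := mul_le_mul_of_nonneg_left h2 hε.le
        nlinarith)
    have := add_nonneg c1 c2
    refine this.trans (le_of_eq ?_)
    ring
  rw [int_Q τ (fun r => f (t - r)) (by fun_prop)] at hQ
  unfold Wd'
  rw [hgd]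
  set Iy := ∫ r in (0:ℝ)..τ, f (t - r)
  set Iyy := ∫ r in (0:ℝ)..τ, f (t - r) ^ 2
  set I1 := ∫ r in (0:ℝ)..τ, r * (τ - r) * f (t - r)
  set I2 := ∫ r in (0:ℝ)..τ, (τ - 2 * r) * f (t - r)
  set J := ∫ r in (0:ℝ)..τ, (f (t - r) ^ 2 + g (t - r) ^ 2)
  have s1 : ε * g t ^ 2 / (4 * τ) * τ = ε * g t ^ 2 / 4 := by field_simp
  have s2 : ε * f t ^ 2 / τ * τ = ε * f t ^ 2 := by field_simp
  have s3 : ε / (8 * τ) * (2 * τ * (f t ^ 2 + g t ^ 2)) = ε / 4 * (f t ^ 2 + g t ^ 2) := by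
    field_simp; ring
  have s4 : 0 ≤ ε / (8 * τ) * (τ * (f (t - τ) ^ 2 + (g t - Iy) ^ 2)) := by positivity
  have s5 : 0 ≤ ε * (g t / 2 - θ) ^ 2 := by positivity
  have s6 : 0 ≤ (a - τ) * f t ^ 2 := mul_nonneg (by linarith) (sq_nonneg _)
  have s7 : ε * A * f t ^ 2 * (τ ^ 3 / 6) = ε * f t ^ 2 * (4 * L ^ 2 + 3) := by rw [← hA6]; ring
  have s8 : 0 ≤ ε * f t ^ 2 := by positivity
  linarith

theorem Wd_lower (τ ε A : ℝ) (hτ : 0 < τ) (hε : 0 < ε)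
    (g f : ℝ → ℝ) (cg : Continuous g) (cf : Continuous f) (t : ℝ) :
    ε / 16 * (∫ r in (0:ℝ)..τ, g (t - r) ^ 2) - 4 * ε * A ^ 2 * τ ^ 3 * g t ^ 2
      ≤ Wd τ ε A g f t := by
  have h : 0 ≤ ∫ r in (0:ℝ)..τ, (1 / 2 * ((τ - r) * f (t - r) ^ 2)
      - ε * A * g t * ((τ - 2 * r) * g (t - r))
      + ε / (8 * τ) * ((2 * τ - r) * (f (t - r) ^ 2 + g (t - r) ^ 2))
      - ε / 16 * g (t - r) ^ 2 + 4 * ε * A ^ 2 * τ ^ 2 * g t ^ 2) := by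
    refine intervalIntegral.integral_nonneg hτ.le ?_
    intro r hr
    have a1 : 0 ≤ 1 / 2 * ((τ - r) * f (t - r) ^ 2) := by
      have : 0 ≤ τ - r := by linarith [hr.2]
      positivity
    have a2 : ε / 8 * g (t - r) ^ 2 ≤
        ε / (8 * τ) * ((2 * τ - r) * (f (t - r) ^ 2 + g (t - r) ^ 2)) := by
      have : τ * g (t - r) ^ 2 ≤ (2 * τ - r) * (f (t - r) ^ 2 + g (t - r) ^ 2) :=
        mul_le_mul (by linarith [hr.2]) (by nlinarith [sq_nonneg (f (t - r))]) (by positivity)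
          (by linarith [hr.2])
      calc ε / 8 * g (t - r) ^ 2 = ε / (8 * τ) * (τ * g (t - r) ^ 2) := by field_simp
        _ ≤ _ := by gcongr
    have a3 := quad_nonneg (1 / 16) (-A * (τ - 2 * r)) (4 * A ^ 2 * τ ^ 2) (g (t - r)) (g t)
      (by norm_num) (by
        have : (τ - 2 * r) ^ 2 ≤ τ ^ 2 := sq_le_sq' (by linarith [hr.2]) (by linarith [hr.1])
        nlinarith [mul_le_mul_of_nonneg_left this (sq_nonneg A)])
    have a4 := mul_nonneg hε.le a3
    linarith
  rw [intervalIntegral.integral_add (Continuous.intervalIntegrable (by fun_prop) _ _)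
      (Continuous.intervalIntegrable (by fun_prop) _ _),
    intervalIntegral.integral_sub (Continuous.intervalIntegrable (by fun_prop) _ _)
      (Continuous.intervalIntegrable (by fun_prop) _ _),
    intervalIntegral.integral_add (Continuous.intervalIntegrable (by fun_prop) _ _)
      (Continuous.intervalIntegrable (by fun_prop) _ _),
    intervalIntegral.integral_sub (Continuous.intervalIntegrable (by fun_prop) _ _)
      (Continuous.intervalIntegrable (by fun_prop) _ _)] at h
  simp only [intervalIntegral.integral_const_mul, intervalIntegral.integral_const] at h
  simp only [smul_eq_mul, sub_zero] at h
  unfold Wd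
  linarith

theorem Wd_upper (τ ε A : ℝ) (hτ : 0 < τ) (hε : 0 < ε) (hε1 : ε ≤ 1)
    (g f : ℝ → ℝ) (cg : Continuous g) (cf : Continuous f) (t : ℝ) :
    Wd τ ε A g f t ≤ (τ + 1) * (∫ r in (0:ℝ)..τ, (f (t - r) ^ 2 + g (t - r) ^ 2))
      + A ^ 2 * τ ^ 3 * g t ^ 2 := by
  have h : 0 ≤ ∫ r in (0:ℝ)..τ, ((τ + 1) * (f (t - r) ^ 2 + g (t - r) ^ 2)
      + A ^ 2 * τ ^ 2 * g t ^ 2 - 1 / 2 * ((τ - r) * f (t - r) ^ 2)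
      + ε * A * g t * ((τ - 2 * r) * g (t - r))
      - ε / (8 * τ) * ((2 * τ - r) * (f (t - r) ^ 2 + g (t - r) ^ 2))) := by
    refine intervalIntegral.integral_nonneg hτ.le ?_
    intro r hr
    have a1 : 1 / 2 * ((τ - r) * f (t - r) ^ 2) ≤ τ / 2 * f (t - r) ^ 2 := by
      have := mul_nonneg hr.1 (sq_nonneg (f (t - r)))
      linarith
    have a2 : ε / (8 * τ) * ((2 * τ - r) * (f (t - r) ^ 2 + g (t - r) ^ 2))
        ≤ 1 / 4 * (f (t - r) ^ 2 + g (t - r) ^ 2) := by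
      calc _ ≤ 1 / (8 * τ) * ((2 * τ) * (f (t - r) ^ 2 + g (t - r) ^ 2)) := by
            gcongr
            · have : 0 ≤ 2 * τ - r := by linarith [hr.2]
              positivity
            · linarith [hr.1]
        _ = _ := by field_simp; ring
    have a3 := quad_nonneg (1 / 2) (ε * A * (τ - 2 * r)) (A ^ 2 * τ ^ 2) (g (t - r)) (g t)
      (by norm_num) (by
        have h1 : (τ - 2 * r) ^ 2 ≤ τ ^ 2 := sq_le_sq' (by linarith [hr.2]) (by linarith [hr.1])
        have h2 : ε ^ 2 ≤ 1 := by nlinarith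
        have h3 : (ε * A * (τ - 2 * r)) ^ 2 ≤ A ^ 2 * τ ^ 2 := by
          calc (ε * A * (τ - 2 * r)) ^ 2 = ε ^ 2 * (A ^ 2 * (τ - 2 * r) ^ 2) := by ring
            _ ≤ 1 * (A ^ 2 * τ ^ 2) := by gcongr
            _ = _ := by ring
        nlinarith [mul_nonneg (sq_nonneg A) (sq_nonneg τ)])
    have a4 : 0 ≤ τ * f (t - r) ^ 2 := by positivity
    have a5 : 0 ≤ τ * g (t - r) ^ 2 := by positivity
    nlinarith [sq_nonneg (f (t - r)), sq_nonneg (g (t - r))]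
  rw [intervalIntegral.integral_sub (Continuous.intervalIntegrable (by fun_prop) _ _)
      (Continuous.intervalIntegrable (by fun_prop) _ _),
    intervalIntegral.integral_add (Continuous.intervalIntegrable (by fun_prop) _ _)
      (Continuous.intervalIntegrable (by fun_prop) _ _),
    intervalIntegral.integral_sub (Continuous.intervalIntegrable (by fun_prop) _ _)
      (Continuous.intervalIntegrable (by fun_prop) _ _),
    intervalIntegral.integral_add (Continuous.intervalIntegrable (by fun_prop) _ _)
      (Continuous.intervalIntegrable (by fun_prop) _ _)] at h
  simp only [intervalIntegral.integral_const_mul, intervalIntegral.integral_const] at h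
  simp only [smul_eq_mul, sub_zero] at h
  unfold Wd
  linarith


/-- All pointwise facts about a solution that are used below. -/
structure Pack (L τ a : ℝ) (u v vt g gx f fx ft θ θt θx θxx : ℝ → ℝ → ℝ) : Prop where
  cu : Continuous (Function.uncurry u)
  cv : Continuous (Function.uncurry v)
  cvt : Continuous (Function.uncurry vt)
  cg : Continuous (Function.uncurry g)
  cgx : Continuous (Function.uncurry gx)
  cf : Continuous (Function.uncurry f)
  cfx : Continuous (Function.uncurry fx)
  cft : Continuous (Function.uncurry ft)
  cθ : Continuous (Function.uncurry θ)
  cθt : Continuous (Function.uncurry θt)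
  cθx : Continuous (Function.uncurry θx)
  cθxx : Continuous (Function.uncurry θxx)
  u_x : ∀ x t, HasDerivAt (fun y => u y t) (g x t) x
  u_t : ∀ x t, HasDerivAt (fun s => u x s) (v x t) t
  v_x : ∀ x t, HasDerivAt (fun y => v y t) (f x t) x
  v_t : ∀ x t, HasDerivAt (fun s => v x s) (vt x t) t
  g_x : ∀ x t, HasDerivAt (fun y => g y t) (gx x t) x
  g_t : ∀ x t, HasDerivAt (fun s => g x s) (f x t) t
  f_x : ∀ x t, HasDerivAt (fun y => f y t) (fx x t) x
  f_t : ∀ x t, HasDerivAt (fun s => f x s) (ft x t) t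
  θ_x : ∀ x t, HasDerivAt (fun y => θ y t) (θx x t) x
  θ_t : ∀ x t, HasDerivAt (fun s => θ x s) (θt x t) t
  θx_x : ∀ x t, HasDerivAt (fun y => θx y t) (θxx x t) x
  p1 : ∀ t ≥ 0, ∀ x ∈ Set.Icc 0 L, vt x t - gx x (t - τ) - a * fx x t + θx x t = 0
  p2 : ∀ t ≥ 0, ∀ x ∈ Set.Icc 0 L, θt x t - θxx x t + f x t = 0
  u0 : ∀ t ≥ 0, u 0 t = 0
  uL : ∀ t ≥ 0, u L t = 0
  v0 : ∀ t ≥ 0, v 0 t = 0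
  vL : ∀ t ≥ 0, v L t = 0
  θ0 : ∀ t ≥ 0, θ 0 t = 0
  θL : ∀ t ≥ 0, θ L t = 0

theorem extend_zero (L : ℝ) (hL : 0 < L) (Φ : ℝ → ℝ → ℝ) (hΦ : Continuous (Function.uncurry Φ))
    (h : ∀ x ∈ Set.Ioo (0:ℝ) L, ∀ t > (0:ℝ), Φ x t = 0) :
    ∀ t ≥ 0, ∀ x ∈ Set.Icc (0:ℝ) L, Φ x t = 0 := by
  intro t ht x hx
  have hcl : IsClosed {p : ℝ × ℝ | Function.uncurry Φ p = 0} := isClosed_eq hΦ continuous_const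
  have hsub : Set.Ioo (0:ℝ) L ×ˢ Set.Ioi (0:ℝ) ⊆ {p : ℝ × ℝ | Function.uncurry Φ p = 0} := by
    rintro ⟨y, s⟩ ⟨hy, hs⟩
    exact h y hy s hs
  have h2 := closure_minimal hsub hcl
  rw [closure_prod_eq, closure_Ioo hL.ne, closure_Ioi] at h2
  exact h2 (Set.mk_mem_prod hx ht)

theorem Sm.unc {f : ℝ → ℝ → ℝ} (h : Sm f) : Continuous (Function.uncurry f) := h.cont

theorem mkPack (L τ a : ℝ) (hL : 0 < L) (hτ : 0 < τ) (u θ : ℝ → ℝ → ℝ)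
    (h : IsSmoothSolKVString L τ a u θ) :
    Pack L τ a u (pdT u) (pdT (pdT u)) (pdX u) (pdX (pdX u)) (pdX (pdT u)) (pdX (pdX (pdT u)))
      (pdT (pdX (pdT u))) θ (pdT θ) (pdX θ) (pdX (pdX θ)) := by
  have su : Sm u := h.smooth_u
  have sθ : Sm θ := h.smooth_θ
  have cgx := su.pdX.pdX.unc
  have cvt := su.pdT.pdT.unc
  have cf := su.pdT.pdX.unc
  have cfx := su.pdT.pdX.pdX.unc
  have cθx := sθ.pdX.unc
  have cθxx := sθ.pdX.pdX.unc
  have cθt := sθ.pdT.unc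
  have bt : ∀ x, (∀ t : ℝ, -τ ≤ t → u x t = 0) → ∀ t ≥ 0, pdT u x t = 0 := by
    intro x hx t ht
    have : (fun s => u x s) =ᶠ[nhds t] fun _ => 0 := by
      filter_upwards [Ici_mem_nhds (show -τ < t by linarith)] with s hs using hx s hs
    unfold pdT
    rw [this.deriv_eq]; simp
  exact
  { cu := su.unc, cv := su.pdT.unc, cvt := cvt, cg := su.pdX.unc, cgx := cgx, cf := cf, cfx := cfx
    cft := su.pdT.pdX.pdT.unc, cθ := sθ.unc, cθt := cθt, cθx := cθx, cθxx := cθxx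
    u_x := su.derX, u_t := su.derT, v_x := su.pdT.derX, v_t := su.pdT.derT
    g_x := su.pdX.derX
    g_t := fun x t => by rw [su.comm]; exact su.pdX.derT x t
    f_x := su.pdT.pdX.derX, f_t := su.pdT.pdX.derT, θ_x := sθ.derX, θ_t := sθ.derT
    θx_x := sθ.pdX.derX
    p1 := extend_zero L hL (fun x t => pdT (pdT u) x t - pdX (pdX u) x (t - τ)
      - a * pdX (pdX (pdT u)) x t + pdX θ x t) (by unfold Function.uncurry; fun_prop) h.pde_u
    p2 := extend_zero L hL (fun x t => pdT θ x t - pdX (pdX θ) x t + pdX (pdT u) x t)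
      (by unfold Function.uncurry; fun_prop) h.pde_θ
    u0 := fun t ht => (h.bc_u t (by linarith)).1
    uL := fun t ht => (h.bc_u t (by linarith)).2
    v0 := bt 0 fun t ht => (h.bc_u t ht).1
    vL := bt L fun t ht => (h.bc_u t ht).2
    θ0 := fun t ht => (h.bc_θ t ht).1
    θL := fun t ht => (h.bc_θ t ht).2 }

/-- Window norm. -/
noncomputable def Zw (L τ : ℝ) (h : ℝ → ℝ → ℝ) (t : ℝ) : ℝ :=
  ∫ x in (0:ℝ)..L, ∫ r in (0:ℝ)..τ, h x (t - r) ^ 2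

/-- Instantaneous energy. -/
noncomputable def Se (L : ℝ) (v g θ : ℝ → ℝ → ℝ) (t : ℝ) : ℝ :=
  ∫ x in (0:ℝ)..L, (v x t ^ 2 + g x t ^ 2 + θ x t ^ 2)

theorem energy_eq (L τ ξ : ℝ) (hτ : 0 < τ) (u θ : ℝ → ℝ → ℝ) (t : ℝ) :
    energyKVString L τ ξ u θ t
      = 1 / 2 * (Se L (pdT u) (pdX u) θ t + ξ / τ * Zw L τ (pdX u) t) := by
  unfold energyKVString Se Zw
  have : ∀ x, ∫ ρ in (0:ℝ)..1, pdX u x (t - τ * ρ) ^ 2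
      = τ⁻¹ * ∫ r in (0:ℝ)..τ, pdX u x (t - r) ^ 2 := by
    intro x
    have := intervalIntegral.integral_comp_mul_left (a := 0) (b := 1)
      (fun r => pdX u x (t - r) ^ 2) hτ.ne'
    simpa using this
  simp only [this, intervalIntegral.integral_const_mul]
  ring

theorem Zw_deriv (L τ : ℝ) (h h' : ℝ → ℝ → ℝ) (ch : Continuous (Function.uncurry h))
    (ch' : Continuous (Function.uncurry h'))
    (hd : ∀ x t, HasDerivAt (fun s => h x s) (h' x t) t) (t : ℝ) :
    HasDerivAt (Zw L τ h) (∫ x in (0:ℝ)..L, (h x t ^ 2 - h x (t - τ) ^ 2)) t := by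
  refine hasDerivAt_param (fun x t => ∫ r in (0:ℝ)..τ, h x (t - r) ^ 2)
    (fun x t => h x t ^ 2 - h x (t - τ) ^ 2) 0 L (by fun_prop) (by fun_prop) ?_ t
  intro x t
  have q1 : ∀ t, HasDerivAt (fun t => h x t ^ 2) (2 * h x t * h' x t) t := fun t => by
    refine ((hd x t).pow 2).congr_deriv ?_
    simp
  have cx : Continuous (fun t => h x t) := by fun_prop
  have cx' : Continuous (fun t => h' x t) := by fun_prop
  have d1 := window_deriv (fun r => 1) _ _ τ (by fun_prop) (by fun_prop) q1 t
  rw [window_parts (fun r => 1) (fun _ => 0) _ _ τ (fun r => hasDerivAt_const r 1) (by fun_prop)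
    (by fun_prop) q1] at d1
  simpa using d1

theorem Qw_deriv (L : ℝ) (h : ℝ → ℝ → ℝ) (ch : Continuous (Function.uncurry h)) (t : ℝ) :
    HasDerivAt (fun t => ∫ x in (0:ℝ)..L, ∫ s in (0:ℝ)..t, h x s ^ 2)
      (∫ x in (0:ℝ)..L, h x t ^ 2) t := by
  refine hasDerivAt_param (fun x t => ∫ s in (0:ℝ)..t, h x s ^ 2)
    (fun x t => h x t ^ 2) 0 L (by fun_prop) (by fun_prop) ?_ t
  intro x t
  have cx : Continuous (fun t => h x t ^ 2) := by fun_prop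
  exact intervalIntegral.integral_hasDerivAt_right (cx.intervalIntegrable _ _)
    (cx.stronglyMeasurableAtFilter _ _) cx.continuousAt

section
variable {L τ a : ℝ} {u v vt g gx f fx ft θ θt θx θxx : ℝ → ℝ → ℝ}

theorem Pack.S_deriv (P : Pack L τ a u v vt g gx f fx ft θ θt θx θxx) (hL : 0 < L)
    (t : ℝ) (ht : 0 ≤ t) :
    HasDerivAt (Se L v g θ)
      (2 * ∫ x in (0:ℝ)..L, (f x t * (g x t - g x (t - τ)) - a * f x t ^ 2 - θx x t ^ 2)) t := by
  obtain ⟨cu, cv, cvt, cg, cgx, cf, cfx, cft, cθ, cθt, cθx, cθxx, u_x, u_t, v_x, v_t, g_x, g_t,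
    f_x, f_t, θ_x, θ_t, θx_x, p1, p2, u0, uL, v0, vL, θ0, θL⟩ := P
  have h1 := hasDerivAt_param (fun x t => v x t ^ 2 + g x t ^ 2 + θ x t ^ 2)
    (fun x t => 2 * (v x t * vt x t + g x t * f x t + θ x t * θt x t)) 0 L
    (by fun_prop) (by fun_prop) (fun x t => by
      refine ((((v_t x t).pow 2).add ((g_t x t).pow 2)).add ((θ_t x t).pow 2)).congr_deriv ?_
      simp; ring) t
  refine h1.congr_deriv ?_
  rw [intervalIntegral.integral_const_mul]
  congr 1
  exact ibp_F L a hL (fun x => v x t) (fun x => vt x t) (fun x => g x t) (fun x => g x (t - τ))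
    (fun x => gx x (t - τ)) (fun x => f x t) (fun x => fx x t) (fun x => θ x t) (fun x => θt x t)
    (fun x => θx x t) (fun x => θxx x t) (fun x => v_x x t) (fun x => g_x x _) (fun x => f_x x t)
    (fun x => θ_x x t) (fun x => θx_x x t) (by fun_prop) (by fun_prop) (by fun_prop)
    (p1 t ht) (p2 t ht) (v0 t ht) (vL t ht) (θ0 t ht) (θL t ht)

theorem Pack.N_deriv (P : Pack L τ a u v vt g gx f fx ft θ θt θx θxx) (hL : 0 < L)
    (t : ℝ) (ht : 0 ≤ t) :
    HasDerivAt (fun t => ∫ x in (0:ℝ)..L, (u x t * v x t + (a - τ) / 2 * g x t ^ 2))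
      (∫ x in (0:ℝ)..L, (v x t ^ 2 - g x t * g x (t - τ) - τ * (g x t * f x t) + g x t * θ x t))
      t := by
  obtain ⟨cu, cv, cvt, cg, cgx, cf, cfx, cft, cθ, cθt, cθx, cθxx, u_x, u_t, v_x, v_t, g_x, g_t,
    f_x, f_t, θ_x, θ_t, θx_x, p1, p2, u0, uL, v0, vL, θ0, θL⟩ := P
  have h1 := hasDerivAt_param (fun x t => u x t * v x t + (a - τ) / 2 * g x t ^ 2)
    (fun x t => v x t ^ 2 + u x t * vt x t + (a - τ) * (g x t * f x t)) 0 L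
    (by fun_prop) (by fun_prop) (fun x t => by
      refine (((u_t x t).mul (v_t x t)).add (((g_t x t).pow 2).const_mul _)).congr_deriv ?_
      simp; ring) t
  refine h1.congr_deriv ?_
  exact ibp_N L a τ hL (fun x => u x t) (fun x => v x t) (fun x => vt x t) (fun x => g x t)
    (fun x => g x (t - τ))
    (fun x => gx x (t - τ)) (fun x => f x t) (fun x => fx x t) (fun x => θ x t)
    (fun x => θx x t) (fun x => u_x x t) (fun x => g_x x _) (fun x => f_x x t)
    (fun x => θ_x x t) (by fun_prop) (by fun_prop) (by fun_prop)
    (p1 t ht) (u0 t ht) (uL t ht)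

theorem Pack.W_deriv (P : Pack L τ a u v vt g gx f fx ft θ θt θx θxx) (ε A t : ℝ) :
    HasDerivAt (fun t => ∫ x in (0:ℝ)..L, Wd τ ε A (g x) (f x) t)
      (∫ x in (0:ℝ)..L, Wd' τ ε A (g x) (f x) t) t := by
  have cg := P.cg
  have cf := P.cf
  have cft := P.cft
  refine hasDerivAt_param (fun x t => Wd τ ε A (g x) (f x) t)
    (fun x t => Wd' τ ε A (g x) (f x) t) 0 L (by unfold Wd; fun_prop) (by unfold Wd'; fun_prop) ?_ t
  intro x t
  exact Wd_deriv τ ε A (g x) (f x) (ft x) (P.g_t x) (P.f_t x) (by fun_prop) t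

theorem Pack.gd (P : Pack L τ a u v vt g gx f fx ft θ θt θx θxx) (x t : ℝ) :
    g x (t - τ) = g x t - ∫ r in (0:ℝ)..τ, f x (t - r) := by
  have cf := P.cf
  have := window_parts (fun _ => 1) (fun _ => 0) (g x) (f x) τ (fun r => hasDerivAt_const r 1)
    (by fun_prop) (by fun_prop) (P.g_t x) t
  simp only [one_mul, zero_mul, intervalIntegral.integral_zero] at this
  linarith

end

section
variable {L τ a : ℝ} {u v vt g gx f fx ft θ θt θx θxx : ℝ → ℝ → ℝ}

theorem Zw_nonneg (L τ : ℝ) (hL : 0 < L) (hτ : 0 < τ) (h : ℝ → ℝ → ℝ) (t : ℝ) : 0 ≤ Zw L τ h t :=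
  intervalIntegral.integral_nonneg hL.le fun _ _ =>
    intervalIntegral.integral_nonneg hτ.le fun _ _ => sq_nonneg _

theorem Se_nonneg (L : ℝ) (hL : 0 < L) (v g θ : ℝ → ℝ → ℝ) (t : ℝ) : 0 ≤ Se L v g θ t :=
  intervalIntegral.integral_nonneg hL.le fun _ _ => by positivity

theorem sq_int_nonneg (L : ℝ) (hL : 0 < L) (h : ℝ → ℝ) : 0 ≤ ∫ x in (0:ℝ)..L, h x ^ 2 :=
  intervalIntegral.integral_nonneg hL.le fun _ _ => sq_nonneg _

/-- Short time estimate. -/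
theorem Pack.short (P : Pack L τ a u v vt g gx f fx ft θ θt θx θxx) (hL : 0 < L) (hτ : 0 < τ)
    (ha : 0 < a) (t : ℝ) (ht : 0 ≤ t) :
    1 / 2 * Se L v g θ t + a / 2 * (∫ x in (0:ℝ)..L, ∫ s in (0:ℝ)..t, f x s ^ 2)
      + 1 / a * Zw L τ g t
    ≤ (1 / 2 * Se L v g θ 0 + 1 / a * Zw L τ g 0) * Real.exp (4 / a * t) := by
  have cg := P.cg
  have cf := P.cf
  have cv := P.cv
  have cθ := P.cθ
  have cθx := P.cθx
  have key := gronwall' (fun t => 1 / 2 * Se L v g θ t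
      + a / 2 * (∫ x in (0:ℝ)..L, ∫ s in (0:ℝ)..t, f x s ^ 2) + 1 / a * Zw L τ g t)
    (fun t => 1 / 2 * (2 * ∫ x in (0:ℝ)..L, (f x t * (g x t - g x (t - τ)) - a * f x t ^ 2
      - θx x t ^ 2)) + a / 2 * (∫ x in (0:ℝ)..L, f x t ^ 2)
      + 1 / a * (∫ x in (0:ℝ)..L, (g x t ^ 2 - g x (t - τ) ^ 2))) (4 / a) 0
    (fun t ht => (((P.S_deriv hL t ht).const_mul _).add ((Qw_deriv L f cf t).const_mul _)).add
      ((Zw_deriv L τ g f cg cf P.g_t t).const_mul _)) ?_ t ht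
  · simpa using key
  · intro t ht
    have h1 : ∫ x in (0:ℝ)..L, (f x t * (g x t - g x (t - τ)) - a * f x t ^ 2 - θx x t ^ 2)
        ≤ ∫ x in (0:ℝ)..L, (2 / a * (v x t ^ 2 + g x t ^ 2 + θ x t ^ 2) - a / 2 * f x t ^ 2
          - 1 / a * (g x t ^ 2 - g x (t - τ) ^ 2)) := by
      refine intervalIntegral.integral_mono_on hL.le
        (Continuous.intervalIntegrable (by fun_prop) _ _)
        (Continuous.intervalIntegrable (by fun_prop) _ _) ?_
      intro x _
      have e1 := quad_nonneg (a / 2) (-1) (1 / (2 * a)) (f x t) (g x t - g x (t - τ)) (by positivity)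
        (by field_simp; norm_num)
      have e2 : 0 ≤ 1 / (2 * a) * (g x t + g x (t - τ)) ^ 2 := by positivity
      have e3 : 0 ≤ 2 / a * (v x t ^ 2 + θ x t ^ 2) := by positivity
      have e4 : 1 / (2 * a) = 1 / a / 2 := by field_simp
      have e5 : 2 / a = 2 * (1 / a) := by ring
      rw [e4] at e1 e2
      rw [e5] at e3 ⊢
      nlinarith [sq_nonneg (θx x t)]
    set X := ∫ x in (0:ℝ)..L, (f x t * (g x t - g x (t - τ)) - a * f x t ^ 2 - θx x t ^ 2)
    rw [intervalIntegral.integral_sub (Continuous.intervalIntegrable (by fun_prop) _ _)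
        (Continuous.intervalIntegrable (by fun_prop) _ _),
      intervalIntegral.integral_sub (Continuous.intervalIntegrable (by fun_prop) _ _)
        (Continuous.intervalIntegrable (by fun_prop) _ _),
      intervalIntegral.integral_const_mul, intervalIntegral.integral_const_mul,
      intervalIntegral.integral_const_mul] at h1
    change _ ≤ 2 / a * Se L v g θ t - _ - _ at h1
    have h2 : 0 ≤ 4 / a * (a / 2 * (∫ x in (0:ℝ)..L, ∫ s in (0:ℝ)..t, f x s ^ 2)) := by
      have : 0 ≤ ∫ x in (0:ℝ)..L, ∫ s in (0:ℝ)..t, f x s ^ 2 :=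
        intervalIntegral.integral_nonneg hL.le fun _ _ =>
          intervalIntegral.integral_nonneg ht fun _ _ => sq_nonneg _
      positivity
    have h3 : 0 ≤ 4 / a * (1 / a * Zw L τ g t) := by
      have := Zw_nonneg L τ hL hτ g t
      positivity
    have h4 : 2 / a * Se L v g θ t = 4 / a * (1 / 2 * Se L v g θ t) := by ring
    linarith

theorem Zw_self (L τ : ℝ) (f : ℝ → ℝ → ℝ) :
    Zw L τ f τ = ∫ x in (0:ℝ)..L, ∫ s in (0:ℝ)..τ, f x s ^ 2 := by
  unfold Zw
  congr 1; ext x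
  have := intervalIntegral.integral_comp_sub_left (a := 0) (b := τ) (fun s => f x s ^ 2) τ
  simpa using this

/-- The Lyapunov functional. -/
noncomputable def Vl (L τ a ε A : ℝ) (u v g f θ : ℝ → ℝ → ℝ) (t : ℝ) : ℝ :=
  1 / 2 * Se L v g θ t
    + ε * (∫ x in (0:ℝ)..L, (u x t * v x t + (a - τ) / 2 * g x t ^ 2))
    + ∫ x in (0:ℝ)..L, Wd τ ε A (g x) (f x) t

/-- Its derivative. -/
noncomputable def Vl' (L τ a ε A : ℝ) (v g f θ θx : ℝ → ℝ → ℝ) (t : ℝ) : ℝ :=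
  1 / 2 * (2 * ∫ x in (0:ℝ)..L, (f x t * (g x t - g x (t - τ)) - a * f x t ^ 2 - θx x t ^ 2))
    + ε * (∫ x in (0:ℝ)..L, (v x t ^ 2 - g x t * g x (t - τ) - τ * (g x t * f x t) + g x t * θ x t))
    + ∫ x in (0:ℝ)..L, Wd' τ ε A (g x) (f x) t

theorem Pack.V_deriv (P : Pack L τ a u v vt g gx f fx ft θ θt θx θxx) (hL : 0 < L) (ε A t : ℝ)
    (ht : 0 ≤ t) :
    HasDerivAt (Vl L τ a ε A u v g f θ) (Vl' L τ a ε A v g f θ θx t) t :=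
  (((P.S_deriv hL t ht).const_mul _).add ((P.N_deriv hL t ht).const_mul _)).add (P.W_deriv ε A t)

theorem Pack.poin (P : Pack L τ a u v vt g gx f fx ft θ θt θx θxx) (hL : 0 < L) (t : ℝ)
    (ht : 0 ≤ t) :
    (∫ x in (0:ℝ)..L, u x t ^ 2 ≤ 4 * L ^ 2 * ∫ x in (0:ℝ)..L, g x t ^ 2) ∧
    (∫ x in (0:ℝ)..L, v x t ^ 2 ≤ 4 * L ^ 2 * ∫ x in (0:ℝ)..L, f x t ^ 2) ∧
    (∫ x in (0:ℝ)..L, θ x t ^ 2 ≤ 4 * L ^ 2 * ∫ x in (0:ℝ)..L, θx x t ^ 2) := by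
  have cg := P.cg
  have cf := P.cf
  have cθx := P.cθx
  exact ⟨poincare L hL (fun x => u x t) (fun x => g x t) (fun x => P.u_x x t) (by fun_prop)
      (P.uL t ht),
    poincare L hL (fun x => v x t) (fun x => f x t) (fun x => P.v_x x t) (by fun_prop)
      (P.vL t ht),
    poincare L hL (fun x => θ x t) (fun x => θx x t) (fun x => P.θ_x x t) (by fun_prop)
      (P.θL t ht)⟩

theorem Pack.Se_eq (P : Pack L τ a u v vt g gx f fx ft θ θt θx θxx) (t : ℝ) :
    Se L v g θ t = (∫ x in (0:ℝ)..L, v x t ^ 2) + (∫ x in (0:ℝ)..L, g x t ^ 2)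
      + ∫ x in (0:ℝ)..L, θ x t ^ 2 := by
  have cg := P.cg
  have cv := P.cv
  have cθ := P.cθ
  unfold Se
  rw [intervalIntegral.integral_add (Continuous.intervalIntegrable (by fun_prop) _ _)
        (Continuous.intervalIntegrable (by fun_prop) _ _),
      intervalIntegral.integral_add (Continuous.intervalIntegrable (by fun_prop) _ _)
        (Continuous.intervalIntegrable (by fun_prop) _ _)]

theorem Pack.win_eq (P : Pack L τ a u v vt g gx f fx ft θ θt θx θxx) (t : ℝ) :
    ∫ x in (0:ℝ)..L, ∫ r in (0:ℝ)..τ, (f x (t - r) ^ 2 + g x (t - r) ^ 2)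
      = Zw L τ f t + Zw L τ g t := by
  have cg := P.cg
  have cf := P.cf
  unfold Zw
  rw [← intervalIntegral.integral_add (Continuous.intervalIntegrable (by fun_prop) _ _)
        (Continuous.intervalIntegrable (by fun_prop) _ _)]
  congr 1; ext x
  rw [intervalIntegral.integral_add (Continuous.intervalIntegrable (by fun_prop) _ _)
        (Continuous.intervalIntegrable (by fun_prop) _ _)]

theorem Pack.V'_le (P : Pack L τ a u v vt g gx f fx ft θ θt θx θxx) (hL : 0 < L) (hτ : 0 < τ)
    (hτa : τ ≤ a) (ε A : ℝ) (hε : 0 < ε) (hA : 0 < A)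
    (hA6 : A * τ ^ 3 / 6 = 4 * L ^ 2 + 3)
    (h1 : 4 * τ * ε * (1 + A * τ) ^ 2 ≤ 1) (h2 : ε * A ^ 2 * τ ^ 5 ≤ 1) (h3 : 8 * L ^ 2 * ε ≤ 1)
    (t : ℝ) (ht : 0 ≤ t) :
    Vl' L τ a ε A v g f θ θx t ≤ - (ε * (∫ x in (0:ℝ)..L, f x t ^ 2)
      + ε / 4 * (∫ x in (0:ℝ)..L, g x t ^ 2) + 1 / 2 * (∫ x in (0:ℝ)..L, θx x t ^ 2)
      + ε / (8 * τ) * (Zw L τ f t + Zw L τ g t)) := by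
  have cg := P.cg
  have cf := P.cf
  have cv := P.cv
  have cθ := P.cθ
  have cθx := P.cθx
  have e1 : Vl' L τ a ε A v g f θ θx t = ∫ x in (0:ℝ)..L,
      ((f x t * (g x t - g x (t - τ)) - a * f x t ^ 2 - θx x t ^ 2)
      + ε * (v x t ^ 2 - g x t * g x (t - τ) - τ * (g x t * f x t) + g x t * θ x t)
      + Wd' τ ε A (g x) (f x) t) := by
    rw [intervalIntegral.integral_add (Continuous.intervalIntegrable (by fun_prop) _ _)
        (Continuous.intervalIntegrable (by unfold Wd'; fun_prop) _ _),
      intervalIntegral.integral_add (Continuous.intervalIntegrable (by fun_prop) _ _)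
        (Continuous.intervalIntegrable (by fun_prop) _ _), intervalIntegral.integral_const_mul]
    unfold Vl'
    ring
  have e2 : Vl' L τ a ε A v g f θ θx t ≤ ∫ x in (0:ℝ)..L,
      (ε * v x t ^ 2 + ε * θ x t ^ 2 - θx x t ^ 2 - ε * (4 * L ^ 2 + 1) * f x t ^ 2
      - ε / 4 * g x t ^ 2
      - ε / (8 * τ) * ∫ r in (0:ℝ)..τ, (f x (t - r) ^ 2 + g x (t - r) ^ 2)) := by
    rw [e1]
    refine intervalIntegral.integral_mono_on hL.le
        (Continuous.intervalIntegrable (by unfold Wd'; fun_prop) _ _)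
        (Continuous.intervalIntegrable (by fun_prop) _ _) ?_
    intro x _
    exact key_pt L τ a ε A hτ hτa hε hA hA6 h1 h2 (g x) (f x) (by fun_prop) (by fun_prop) t
      (v x t) (θ x t) (θx x t) (P.gd x t)
  rw [intervalIntegral.integral_sub (Continuous.intervalIntegrable (by fun_prop) _ _)
        (Continuous.intervalIntegrable (by fun_prop) _ _),
      intervalIntegral.integral_sub (Continuous.intervalIntegrable (by fun_prop) _ _)
        (Continuous.intervalIntegrable (by fun_prop) _ _),
      intervalIntegral.integral_sub (Continuous.intervalIntegrable (by fun_prop) _ _)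
        (Continuous.intervalIntegrable (by fun_prop) _ _),
      intervalIntegral.integral_sub (Continuous.intervalIntegrable (by fun_prop) _ _)
        (Continuous.intervalIntegrable (by fun_prop) _ _),
      intervalIntegral.integral_add (Continuous.intervalIntegrable (by fun_prop) _ _)
        (Continuous.intervalIntegrable (by fun_prop) _ _)] at e2
  simp only [intervalIntegral.integral_const_mul, P.win_eq] at e2
  obtain ⟨_, pv, pθ⟩ := P.poin hL t ht
  have a1 := mul_le_mul_of_nonneg_left pv hε.le
  have a2 := mul_le_mul_of_nonneg_left pθ hε.le
  have a3 := mul_le_mul_of_nonneg_right h3 (sq_int_nonneg L hL (fun x => θx x t))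
  linarith

theorem Pack.V_lower (P : Pack L τ a u v vt g gx f fx ft θ θt θx θxx) (hL : 0 < L) (hτ : 0 < τ)
    (hτa : τ ≤ a) (ε A : ℝ) (hε : 0 < ε) (hε1 : ε ≤ 1 / 2)
    (h4 : ε * (2 * L ^ 2 + 4 * A ^ 2 * τ ^ 3) ≤ 1 / 4) (t : ℝ) (ht : 0 ≤ t) :
    1 / 4 * Se L v g θ t + ε / 16 * Zw L τ g t ≤ Vl L τ a ε A u v g f θ t := by
  have cu := P.cu
  have cg := P.cg
  have cf := P.cf
  have cv := P.cv
  have cθ := P.cθ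
  have w1 : ∫ x in (0:ℝ)..L, (ε / 16 * (∫ r in (0:ℝ)..τ, g x (t - r) ^ 2)
      - 4 * ε * A ^ 2 * τ ^ 3 * g x t ^ 2) ≤ ∫ x in (0:ℝ)..L, Wd τ ε A (g x) (f x) t := by
    refine intervalIntegral.integral_mono_on hL.le
        (Continuous.intervalIntegrable (by fun_prop) _ _)
        (Continuous.intervalIntegrable (by unfold Wd; fun_prop) _ _) ?_
    intro x _
    exact Wd_lower τ ε A hτ hε (g x) (f x) (by fun_prop) (by fun_prop) t
  have w2 : ∫ x in (0:ℝ)..L, (-(1 / 2) * u x t ^ 2 - 1 / 2 * v x t ^ 2) ≤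
      ∫ x in (0:ℝ)..L, (u x t * v x t + (a - τ) / 2 * g x t ^ 2) := by
    refine intervalIntegral.integral_mono_on hL.le
        (Continuous.intervalIntegrable (by fun_prop) _ _)
        (Continuous.intervalIntegrable (by fun_prop) _ _) ?_
    intro x _
    have : 0 ≤ (a - τ) / 2 * g x t ^ 2 := mul_nonneg (by linarith) (sq_nonneg _)
    nlinarith [sq_nonneg (u x t + v x t)]
  rw [intervalIntegral.integral_sub (Continuous.intervalIntegrable (by fun_prop) _ _)
        (Continuous.intervalIntegrable (by fun_prop) _ _)] at w1 w2
  simp only [intervalIntegral.integral_const_mul] at w1 w2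
  change ε / 16 * Zw L τ g t - _ ≤ _ at w1
  unfold Vl
  obtain ⟨pu, _, _⟩ := P.poin hL t ht
  rw [P.Se_eq]
  have a1 := mul_le_mul_of_nonneg_left pu hε.le
  have a2 := mul_le_mul_of_nonneg_left w2 hε.le
  have a3 := mul_le_mul_of_nonneg_right h4 (sq_int_nonneg L hL (fun x => g x t))
  have a4 := mul_le_mul_of_nonneg_right hε1 (sq_int_nonneg L hL (fun x => v x t))
  have a5 := sq_int_nonneg L hL (fun x => θ x t)
  linarith

theorem Pack.V_upper (P : Pack L τ a u v vt g gx f fx ft θ θt θx θxx) (hL : 0 < L) (hτ : 0 < τ)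
    (hτa : τ ≤ a) (ε A : ℝ) (hε : 0 < ε) (hε1 : ε ≤ 1 / 2) (t : ℝ) (ht : 0 ≤ t) :
    Vl L τ a ε A u v g f θ t ≤ (1 + 2 * L ^ 2 + a + τ + A ^ 2 * τ ^ 3)
      * (Se L v g θ t + Zw L τ f t + Zw L τ g t) := by
  have cu := P.cu
  have cg := P.cg
  have cf := P.cf
  have cv := P.cv
  have cθ := P.cθ
  have w1 : ∫ x in (0:ℝ)..L, Wd τ ε A (g x) (f x) t ≤ ∫ x in (0:ℝ)..L,
      ((τ + 1) * (∫ r in (0:ℝ)..τ, (f x (t - r) ^ 2 + g x (t - r) ^ 2))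
      + A ^ 2 * τ ^ 3 * g x t ^ 2) := by
    refine intervalIntegral.integral_mono_on hL.le
        (Continuous.intervalIntegrable (by unfold Wd; fun_prop) _ _)
        (Continuous.intervalIntegrable (by fun_prop) _ _) ?_
    intro x _
    exact Wd_upper τ ε A hτ hε (by linarith) (g x) (f x) (by fun_prop) (by fun_prop) t
  have w2 : ∫ x in (0:ℝ)..L, (u x t * v x t + (a - τ) / 2 * g x t ^ 2) ≤
      ∫ x in (0:ℝ)..L, (1 / 2 * u x t ^ 2 + 1 / 2 * v x t ^ 2 + a * g x t ^ 2) := by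
    refine intervalIntegral.integral_mono_on hL.le
        (Continuous.intervalIntegrable (by fun_prop) _ _)
        (Continuous.intervalIntegrable (by fun_prop) _ _) ?_
    intro x _
    have : 0 ≤ (a + τ) / 2 * g x t ^ 2 := mul_nonneg (by linarith) (sq_nonneg _)
    nlinarith [sq_nonneg (u x t - v x t)]
  unfold Vl
  set X := ∫ x in (0:ℝ)..L, (u x t * v x t + (a - τ) / 2 * g x t ^ 2)
  rw [intervalIntegral.integral_add (Continuous.intervalIntegrable (by fun_prop) _ _)
        (Continuous.intervalIntegrable (by fun_prop) _ _)] at w1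
  rw [intervalIntegral.integral_add (Continuous.intervalIntegrable (by fun_prop) _ _)
        (Continuous.intervalIntegrable (by fun_prop) _ _),
     intervalIntegral.integral_add (Continuous.intervalIntegrable (by fun_prop) _ _)
        (Continuous.intervalIntegrable (by fun_prop) _ _)] at w2
  simp only [intervalIntegral.integral_const_mul, P.win_eq] at w1 w2
  obtain ⟨pu, _, _⟩ := P.poin hL t ht
  rw [P.Se_eq]
  have n1 := sq_int_nonneg L hL (fun x => g x t)
  have n2 := sq_int_nonneg L hL (fun x => v x t)
  have n3 := sq_int_nonneg L hL (fun x => θ x t)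
  have n4 := sq_int_nonneg L hL (fun x => u x t)
  have n5 := Zw_nonneg L τ hL hτ f t
  have n6 := Zw_nonneg L τ hL hτ g t
  have ha : 0 < a := by linarith
  set G := ∫ x in (0:ℝ)..L, g x t ^ 2
  set Vv := ∫ x in (0:ℝ)..L, v x t ^ 2
  set Th := ∫ x in (0:ℝ)..L, θ x t ^ 2
  set Uu := ∫ x in (0:ℝ)..L, u x t ^ 2
  set Zf := Zw L τ f t
  set Zg := Zw L τ g t
  have a2 := mul_le_mul_of_nonneg_left w2 hε.le
  have a3 : ε * (1 / 2 * Uu + 1 / 2 * Vv + a * G) ≤ 1 / 2 * (1 / 2 * Uu + 1 / 2 * Vv + a * G) :=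
    mul_le_mul_of_nonneg_right hε1 (by positivity)
  have b1 : 0 ≤ (2 * L ^ 2 + a + τ + A ^ 2 * τ ^ 3) * (Vv + Th) := by positivity
  have b2 : 0 ≤ (2 * L ^ 2 + a + A ^ 2 * τ ^ 3) * (Zf + Zg) := by positivity
  have b3 : 0 ≤ (L ^ 2 + a / 2 + τ) * G := by positivity
  linarith

/-- Exponential decay of the Lyapunov functional. -/
theorem Pack.V_decay (P : Pack L τ a u v vt g gx f fx ft θ θt θx θxx) (hL : 0 < L) (hτ : 0 < τ)
    (hτa : τ ≤ a) (ε A w : ℝ) (hε : 0 < ε) (hA : 0 < A)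
    (hA6 : A * τ ^ 3 / 6 = 4 * L ^ 2 + 3)
    (h1 : 4 * τ * ε * (1 + A * τ) ^ 2 ≤ 1) (h2 : ε * A ^ 2 * τ ^ 5 ≤ 1) (h3 : 8 * L ^ 2 * ε ≤ 1)
    (hε1 : ε ≤ 1 / 2) (hw : 0 < w)
    (hw1 : w * ((1 + 2 * L ^ 2 + a + τ + A ^ 2 * τ ^ 3) * (1 + 4 * L ^ 2)) ≤ ε / 4)
    (hw2 : w * ((1 + 2 * L ^ 2 + a + τ + A ^ 2 * τ ^ 3) * (1 + 4 * L ^ 2)) ≤ ε / (8 * τ))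
    (t : ℝ) (ht : τ ≤ t) :
    Vl L τ a ε A u v g f θ t ≤ Vl L τ a ε A u v g f θ τ * Real.exp (-w * (t - τ)) := by
  refine gronwall' _ (Vl' L τ a ε A v g f θ θx) (-w) τ
    (fun t ht => P.V_deriv hL ε A t (by linarith)) ?_ t ht
  intro t ht
  have ht0 : 0 ≤ t := by linarith
  have d1 := P.V'_le hL hτ hτa ε A hε hA hA6 h1 h2 h3 t ht0
  have d2 := mul_le_mul_of_nonneg_left (P.V_upper hL hτ hτa ε A hε hε1 t ht0) hw.le
  rw [P.Se_eq] at d2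
  obtain ⟨_, pv, pθ⟩ := P.poin hL t ht0
  have n1 := sq_int_nonneg L hL (fun x => g x t)
  have n2 := sq_int_nonneg L hL (fun x => f x t)
  have n3 := sq_int_nonneg L hL (fun x => θx x t)
  have n5 := Zw_nonneg L τ hL hτ f t
  have n6 := Zw_nonneg L τ hL hτ g t
  have ha : 0 < a := by linarith
  set G := ∫ x in (0:ℝ)..L, g x t ^ 2
  set Vv := ∫ x in (0:ℝ)..L, v x t ^ 2
  set Th := ∫ x in (0:ℝ)..L, θ x t ^ 2
  set Tx := ∫ x in (0:ℝ)..L, θx x t ^ 2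
  set Ff := ∫ x in (0:ℝ)..L, f x t ^ 2
  set Zf := Zw L τ f t
  set Zg := Zw L τ g t
  set c := 1 + 2 * L ^ 2 + a + τ + A ^ 2 * τ ^ 3
  have hc : 0 < c := by positivity
  have d3 : w * (c * (Vv + G + Th + Zf + Zg))
      ≤ w * (c * ((1 + 4 * L ^ 2) * (Ff + G + Tx + Zf + Zg))) := by
    have q1 : 0 ≤ 4 * L ^ 2 * (G + Zf + Zg) := by positivity
    gcongr
    linarith
  have d4 := mul_le_mul_of_nonneg_right hw1 (by positivity : 0 ≤ Ff + G + Tx)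
  have d5 := mul_le_mul_of_nonneg_right hw2 (by positivity : 0 ≤ Zf + Zg)
  have d6 : 0 ≤ ε * Ff := by positivity
  have d7 : ε * Tx ≤ 1 / 2 * Tx := mul_le_mul_of_nonneg_right hε1 n3
  have d8 : 0 ≤ ε * Tx := by positivity
  linarith

end

set_option maxHeartbeats 4000000 in
/-- Exponential stability of the delayed thermoelastic string with Kelvin–Voigt
damping when `0 < τ ≤ a` and `ξ ≥ 2τ/a`. -/
theorem exponential_stability_KVstring
    (L τ a ξ : ℝ) (hL : 0 < L) (hτ : 0 < τ) (hτa : τ ≤ a) (hξ : 2 * τ / a ≤ ξ) :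
    ∃ C > (0 : ℝ), ∃ w > (0 : ℝ), ∀ u θ : ℝ → ℝ → ℝ,
      IsSmoothSolKVString L τ a u θ →
      ∀ t ≥ (0 : ℝ),
        energyKVString L τ ξ u θ t ≤ C * Real.exp (-w * t) * energyKVString L τ ξ u θ 0 := by
  have ha : 0 < a := by linarith
  have hξ0 : 0 < ξ := lt_of_lt_of_le (by positivity) hξ
  obtain ⟨A, hAdef⟩ : ∃ A, A = 6 * (4 * L ^ 2 + 3) / τ ^ 3 := ⟨_, rfl⟩
  have hA : 0 < A := by rw [hAdef]; positivity
  have hA6 : A * τ ^ 3 / 6 = 4 * L ^ 2 + 3 := by rw [hAdef]; field_simp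
  obtain ⟨M, hM⟩ : ∃ M, M = 2 + 4 * τ * (1 + A * τ) ^ 2 + A ^ 2 * τ ^ 5 + 8 * L ^ 2
    + 4 * (2 * L ^ 2 + 4 * A ^ 2 * τ ^ 3) := ⟨_, rfl⟩
  have m1 : 0 < 4 * τ * (1 + A * τ) ^ 2 := by positivity
  have m2 : 0 < A ^ 2 * τ ^ 5 := by positivity
  have m3 : 0 < L ^ 2 := by positivity
  have m4 : 0 < A ^ 2 * τ ^ 3 := by positivity
  have hMpos : 0 < M := by rw [hM]; positivity
  obtain ⟨ε, hεM⟩ : ∃ ε, ε = 1 / M := ⟨_, rfl⟩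
  have hε : 0 < ε := by rw [hεM]; positivity
  have hle : ∀ z, z ≤ M → ε * z ≤ 1 := by
    intro z hz
    rw [hεM, one_div_mul_eq_div, div_le_one hMpos]; exact hz
  have h1 : 4 * τ * ε * (1 + A * τ) ^ 2 ≤ 1 := by
    linarith [hle (4 * τ * (1 + A * τ) ^ 2) (by rw [hM]; linarith)]
  have h2 : ε * A ^ 2 * τ ^ 5 ≤ 1 := by
    linarith [hle (A ^ 2 * τ ^ 5) (by rw [hM]; linarith)]
  have h3 : 8 * L ^ 2 * ε ≤ 1 := by
    linarith [hle (8 * L ^ 2) (by rw [hM]; linarith)]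
  have h4 : ε * (2 * L ^ 2 + 4 * A ^ 2 * τ ^ 3) ≤ 1 / 4 := by
    linarith [hle (4 * (2 * L ^ 2 + 4 * A ^ 2 * τ ^ 3)) (by rw [hM]; linarith)]
  have hε1 : ε ≤ 1 / 2 := by
    linarith [hle 2 (by rw [hM]; linarith)]
  obtain ⟨c, hc⟩ : ∃ c, c = 1 + 2 * L ^ 2 + a + τ + A ^ 2 * τ ^ 3 := ⟨_, rfl⟩
  have hcpos : 0 < c := by rw [hc]; positivity
  obtain ⟨w, hwdef⟩ : ∃ w, w = ε / (4 + 8 * τ) / (c * (1 + 4 * L ^ 2)) := ⟨_, rfl⟩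
  have hw : 0 < w := by rw [hwdef]; positivity
  have hwc : w * (c * (1 + 4 * L ^ 2)) = ε / (4 + 8 * τ) := by
    rw [hwdef]; exact div_mul_cancel₀ _ (by positivity)
  have hw1 : w * (c * (1 + 4 * L ^ 2)) ≤ ε / 4 := by
    rw [hwc]; exact div_le_div_of_nonneg_left hε.le (by norm_num) (by linarith)
  have hw2 : w * (c * (1 + 4 * L ^ 2)) ≤ ε / (8 * τ) := by
    rw [hwc]; exact div_le_div_of_nonneg_left hε.le (by positivity) (by linarith)
  obtain ⟨C0, hC0⟩ : ∃ C, C = 1 + 2 * τ / (a * ξ) := ⟨_, rfl⟩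
  obtain ⟨C3, hC3⟩ : ∃ C, C = 1 + a * ξ / (2 * τ) := ⟨_, rfl⟩
  obtain ⟨C4, hC4⟩ : ∃ C, C = 2 + 8 * ξ / (τ * ε) := ⟨_, rfl⟩
  obtain ⟨C5, hC5⟩ : ∃ C, C = 2 + 2 / a + a := ⟨_, rfl⟩
  obtain ⟨K, hK⟩ : ∃ K, K = Real.exp (4 / a * τ) := ⟨_, rfl⟩
  have pC0 : 0 < C0 := by rw [hC0]; positivity
  have pC3 : 0 < C3 := by rw [hC3]; positivity
  have pC4 : 0 < C4 := by rw [hC4]; positivity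
  have pC5 : 0 < C5 := by rw [hC5]; positivity
  have pK : 0 < K := by rw [hK]; positivity
  refine ⟨(C3 + C4 * c * C5) * K * C0 * Real.exp (w * τ), by positivity, w, hw, ?_⟩
  intro u θ hsol t ht
  have P := mkPack L τ a hL hτ u θ hsol
  have hexp : Real.exp (w * τ) * Real.exp (-w * t) = Real.exp (-w * (t - τ)) := by
    rw [← Real.exp_add]; congr 1; ring
  have hY0 : 1 / 2 * Se L (pdT u) (pdX u) θ 0 + 1 / a * Zw L τ (pdX u) 0
      ≤ C0 * energyKVString L τ ξ u θ 0 := by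
    rw [energy_eq L τ ξ hτ]
    have n1 := Se_nonneg L hL (pdT u) (pdX u) θ 0
    have n2 := Zw_nonneg L τ hL hτ (pdX u) 0
    set S := Se L (pdT u) (pdX u) θ 0
    set Z := Zw L τ (pdX u) 0
    have e : C0 * (1 / 2 * (S + ξ / τ * Z)) = 1 / 2 * S + 1 / a * Z
        + (τ / (a * ξ) * S + ξ / (2 * τ) * Z) := by
      rw [hC0]; field_simp; ring
    rw [e]
    have : 0 ≤ τ / (a * ξ) * S + ξ / (2 * τ) * Z := by positivity
    linarith
  have hE0 : 0 ≤ energyKVString L τ ξ u θ 0 := by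
    rw [energy_eq L τ ξ hτ]
    have n1 := Se_nonneg L hL (pdT u) (pdX u) θ 0
    have n2 := Zw_nonneg L τ hL hτ (pdX u) 0
    positivity
  have hn0 : 0 ≤ 1 / 2 * Se L (pdT u) (pdX u) θ 0 + 1 / a * Zw L τ (pdX u) 0 := by
    have n1 := Se_nonneg L hL (pdT u) (pdX u) θ 0
    have n2 := Zw_nonneg L τ hL hτ (pdX u) 0
    positivity
  have hY : ∀ s, 0 ≤ s → s ≤ τ → 1 / 2 * Se L (pdT u) (pdX u) θ s
      + a / 2 * (∫ x in (0:ℝ)..L, ∫ r in (0:ℝ)..s, pdX (pdT u) x r ^ 2)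
      + 1 / a * Zw L τ (pdX u) s ≤ K * C0 * energyKVString L τ ξ u θ 0 := by
    intro s hs hs'
    refine (P.short hL hτ ha s hs).trans ?_
    calc _ ≤ (1 / 2 * Se L (pdT u) (pdX u) θ 0 + 1 / a * Zw L τ (pdX u) 0) * K := by
          rw [hK]; gcongr
      _ ≤ (C0 * energyKVString L τ ξ u θ 0) * K := by gcongr
      _ = _ := by ring
  have hgoal : (C3 + C4 * c * C5) * K * C0 * Real.exp (w * τ) * Real.exp (-w * t)
      * energyKVString L τ ξ u θ 0 = (C3 + C4 * c * C5) * (K * C0 * energyKVString L τ ξ u θ 0)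
        * Real.exp (-w * (t - τ)) := by
    rw [← hexp]; ring
  rw [hgoal]
  have hB : 0 ≤ K * C0 * energyKVString L τ ξ u θ 0 := by positivity
  obtain ⟨B, hBdef⟩ : ∃ B, B = K * C0 * energyKVString L τ ξ u θ 0 := ⟨_, rfl⟩
  rw [← hBdef] at hB hY ⊢
  rw [energy_eq L τ ξ hτ]
  have n1 := Se_nonneg L hL (pdT u) (pdX u) θ t
  have n2 := Zw_nonneg L τ hL hτ (pdX u) t
  rcases le_total t τ with htτ | htτ
  · have y := hY t ht htτ
    have n3 : 0 ≤ ∫ x in (0:ℝ)..L, ∫ r in (0:ℝ)..t, pdX (pdT u) x r ^ 2 :=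
      intervalIntegral.integral_nonneg hL.le fun _ _ =>
          intervalIntegral.integral_nonneg ht fun _ _ => sq_nonneg _
    set I := ∫ x in (0:ℝ)..L, ∫ r in (0:ℝ)..t, pdX (pdT u) x r ^ 2
    set S := Se L (pdT u) (pdX u) θ t
    set Z := Zw L τ (pdX u) t
    have e : C3 * (1 / 2 * S + a / 2 * I + 1 / a * Z) = 1 / 2 * (S + ξ / τ * Z)
        + (C3 * (a / 2 * I) + a * ξ / (4 * τ) * S + 1 / a * Z) := by
      rw [hC3]; field_simp; ring
    have e2 : 0 ≤ C3 * (a / 2 * I) + a * ξ / (4 * τ) * S + 1 / a * Z := by positivity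
    have e3 := mul_le_mul_of_nonneg_left y pC3.le
    have e4 : 1 ≤ Real.exp (-w * (t - τ)) := Real.one_le_exp (by nlinarith)
    calc _ ≤ C3 * B := by linarith
      _ ≤ (C3 + C4 * c * C5) * B := by
        have : 0 ≤ C4 * c * C5 * B := by positivity
        linarith
      _ ≤ _ := le_mul_of_one_le_right (by positivity) e4
  · have y := hY τ hτ.le le_rfl
    rw [← Zw_self] at y
    have v1 := P.V_lower hL hτ hτa ε A hε hε1 h4 t ht
    have v2 := P.V_upper hL hτ hτa ε A hε hε1 τ hτ.le
    rw [hc] at hw1 hw2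
    have v3 := P.V_decay hL hτ hτa ε A w hε hA hA6 h1 h2 h3 hε1 hw hw1 hw2 t htτ
    rw [← hc] at v2
    have k1 := Se_nonneg L hL (pdT u) (pdX u) θ τ
    have k2 := Zw_nonneg L τ hL hτ (pdX u) τ
    have k3 := Zw_nonneg L τ hL hτ (pdX (pdT u)) τ
    set S := Se L (pdT u) (pdX u) θ t
    set Z := Zw L τ (pdX u) t
    set S1 := Se L (pdT u) (pdX u) θ τ
    set Z1 := Zw L τ (pdX u) τ
    set Y1 := Zw L τ (pdX (pdT u)) τ
    have f1 : S1 + Y1 + Z1 ≤ C5 * B := by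
      have e3 := mul_le_mul_of_nonneg_left y pC5.le
      have e : C5 * (1 / 2 * S1 + a / 2 * Y1 + 1 / a * Z1) = S1 + Y1 + Z1
          + ((2 / a + a) / 2 * S1 + (2 + a) * a / 2 * Y1 + (2 + 2 / a) / a * Z1) := by
        rw [hC5]; field_simp; ring
      have e2 : 0 ≤ (2 / a + a) / 2 * S1 + (2 + a) * a / 2 * Y1 + (2 + 2 / a) / a * Z1 := by
        positivity
      linarith
    have f2 : 1 / 2 * (S + ξ / τ * Z) ≤ C4 * (1 / 4 * S + ε / 16 * Z) := by
      have e : C4 * (1 / 4 * S + ε / 16 * Z) = 1 / 2 * (S + ξ / τ * Z)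
          + (2 * ξ / (τ * ε) * S + ε / 8 * Z) := by
        rw [hC4]; field_simp; ring
      have e2 : 0 ≤ 2 * ξ / (τ * ε) * S + ε / 8 * Z := by positivity
      linarith
    calc _ ≤ C4 * (1 / 4 * S + ε / 16 * Z) := f2
      _ ≤ C4 * ((c * (C5 * B)) * Real.exp (-w * (t - τ))) := by
        refine mul_le_mul_of_nonneg_left (v1.trans (v3.trans ?_)) pC4.le
        refine mul_le_mul_of_nonneg_right (v2.trans ?_) (Real.exp_pos _).le
        exact mul_le_mul_of_nonneg_left f1 hcpos.le
      _ ≤ _ := by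
        have : 0 ≤ C3 * B * Real.exp (-w * (t - τ)) := by positivity
        linarith
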